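/- arXiv:1405.3051 — 2 statements merged into one kernel-verified Lean document; each statement's English description precedes it below -/
import Mathlib

section
/- Let (W,S) be a Coxeter system with length function ℓ, and let w ∈ W be strongly real, i.e. w = xy for some x, y ∈ W with x² = 1 = y². Then there exists an element w* in the W-conjugacy class of w and elements σ, τ ∈ W with σ² = 1 = τ², w* = στ, and ℓ(w*) = ℓ(σ) + ℓ(τ). (Equivalently, every strongly real conjugacy class of W contains an element of excess zero.) -/
namespace ExcessZero

open CoxeterSystem List

variable {B W : Type*} [Group W] {M : CoxeterMatrix B} (cs : CoxeterSystem M W)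

open Classical in
/-- The action of a simple reflection on `W × ZMod 2`. -/
noncomputable def act (i : B) (p : W × ZMod 2) : W × ZMod 2 :=
  (cs.simple i * p.1 * cs.simple i, p.2 + if p.1 = cs.simple i then 1 else 0)

open Classical in
theorem act_pow (i j : B) (n : ℕ) (t : W) (e : ZMod 2) :
    ((act cs i ∘ act cs j)^[n]) (t, e) =
      ((cs.simple i * cs.simple j) ^ n * t * ((cs.simple i * cs.simple j) ^ n)⁻¹,
        e + ∑ k ∈ Finset.range (2 * n),
          if ((cs.simple i * cs.simple j) ^ k * t = cs.simple j) then 1 else 0) := by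
  set a := cs.simple i with ha
  set b := cs.simple j with hb
  have haa : a * a = 1 := cs.simple_mul_simple_self i
  have hbb : b * b = 1 := cs.simple_mul_simple_self j
  have hai : a⁻¹ = a := cs.inv_simple i
  have hbi : b⁻¹ = b := cs.inv_simple j
  have key : ∀ k : ℕ, b * ((a * b) ^ k) = ((a * b) ^ k)⁻¹ * b := by
    intro k
    induction k with
    | zero => simp
    | succ k ih =>
      rw [pow_succ, ← mul_assoc, ih, mul_inv_rev, mul_assoc]
      rw [show ((a * b) ^ k)⁻¹ * (b * (a * b)) = ((a * b) ^ k)⁻¹ * (a * b)⁻¹ * b by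
        rw [mul_inv_rev, hai, hbi]; simp only [mul_assoc]]
      rw [← mul_inv_rev, ← mul_inv_rev, ← pow_succ, ← pow_succ']
  have c1 : ∀ (k : ℕ), ((a * b) ^ k * t * ((a * b) ^ k)⁻¹ = b) ↔ (a * b) ^ (2 * k) * t = b := by
    intro k
    rw [mul_inv_eq_iff_eq_mul, key, eq_inv_mul_iff_mul_eq, two_mul, pow_add]
    simp only [mul_assoc]
  have c2 : ∀ (k : ℕ), (b * ((a * b) ^ k * t * ((a * b) ^ k)⁻¹) * b = a) ↔
      (a * b) ^ (2 * k + 1) * t = b := by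
    intro k
    have h1 : ∀ z : W, b * z * b = a ↔ a * b * z = b := by
      intro z
      constructor
      · intro h
        have : a * (b * z * b) * b = a * a * b := by rw [h]
        rw [haa, one_mul] at this
        calc a * b * z = a * (b * z * b) * b := by
              simp only [mul_assoc, hbb, mul_one]
          _ = b := this
      · intro h
        have : a * (a * b * z) * b = a * b * b := by rw [h]
        rw [mul_assoc a b b, hbb, mul_one] at this
        rw [← this]; simp only [← mul_assoc, haa, one_mul]
    rw [h1]
    rw [← mul_assoc, mul_inv_eq_iff_eq_mul, key, eq_inv_mul_iff_mul_eq,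
      show 2 * k + 1 = k + 1 + k by ring, pow_add, pow_succ]
    have : (a * b) ^ k * (a * b) * (a * b) ^ k = (a * b) ^ k * ((a * b) * (a * b) ^ k) := by
      rw [mul_assoc]
    simp only [mul_assoc]
  induction n with
  | zero => simp
  | succ n ih =>
    rw [Function.iterate_succ_apply', ih, Function.comp]
    simp only [act, ← ha, ← hb]
    rw [show 2 * (n + 1) = 2 * n + 1 + 1 by ring, Finset.sum_range_succ, Finset.sum_range_succ]
    ext1
    · simp only [pow_succ', mul_inv_rev, hai, hbi, mul_assoc]
    · simp only [c1, c2, add_assoc]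

/-- The action as an element of `Function.End`. -/
noncomputable def actE (i : B) : Function.End (W × ZMod 2) := act cs i

theorem act_liftable : M.IsLiftable (actE cs) := by
  classical
  intro i j
  funext ⟨t, e⟩
  have h1 : ∀ n : ℕ, ∀ p, ((actE cs i * actE cs j) ^ n : Function.End (W × ZMod 2)) p
      = ((act cs i ∘ act cs j)^[n]) p := by
    intro n
    induction n with
    | zero => intro p; rfl
    | succ n ih =>
      intro p
      rw [pow_succ]
      exact ih (act cs i (act cs j p))
  refine (h1 _ _).trans ?_
  rw [act_pow]
  change _ = (t, e)
  have hp := cs.simple_mul_simple_pow i j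
  rw [hp, two_mul, Finset.sum_range_add]
  simp only [pow_add, hp, one_mul, ← two_mul]
  rw [show (2 : ZMod 2) = 0 from rfl]
  simp

noncomputable def rep : W →* Function.End (W × ZMod 2) := cs.lift ⟨actE cs, act_liftable cs⟩

theorem rep_simple (i : B) : rep cs (cs.simple i) = actE cs i := cs.lift_apply_simple _ i

open Classical in
theorem rep_word (ω : List B) (t : W) (e : ZMod 2) :
    rep cs (cs.wordProd ω) (t, e) =
      (cs.wordProd ω * t * (cs.wordProd ω)⁻¹, e + ((cs.rightInvSeq ω).count t : ZMod 2)) := by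
  induction ω with
  | nil => simp; rfl
  | cons i ω ih =>
    rw [wordProd_cons, map_mul]
    change rep cs (cs.simple i) (rep cs (cs.wordProd ω) (t, e)) = _
    rw [ih, rep_simple]
    simp only [actE, act, rightInvSeq, count_cons]
    ext1
    · simp [mul_assoc]
    · have : (cs.wordProd ω * t * (cs.wordProd ω)⁻¹ = cs.simple i) ↔
        ((cs.wordProd ω)⁻¹ * cs.simple i * cs.wordProd ω = t) := by
        constructor
        · intro h; rw [← h]; group
        · intro h; rw [← h]; group
      simp only [this, beq_iff_eq]
      push_cast
      ring

/-- parity -/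
noncomputable def par (w t : W) : ZMod 2 := (rep cs w (t, 0)).2

theorem par_zero {ω : List B} {t : W} (h : t ∉ cs.rightInvSeq ω) : par cs (cs.wordProd ω) t = 0 := by
  classical
  rw [par, rep_word, count_eq_zero_of_not_mem h]; simp

theorem par_mul_simple (w : W) (i : B) :
    par cs (w * cs.simple i) (cs.simple i) = par cs w (cs.simple i) + 1 := by
  classical
  obtain ⟨ω, _, rfl⟩ := cs.exists_isReduced w
  rw [par, par, map_mul]
  change (rep cs (cs.wordProd ω) (rep cs (cs.simple i) (cs.simple i, 0))).2 = _
  rw [rep_simple]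
  simp [actE, act, rep_word]
  ring

theorem exchange {ω : List B} (hω : cs.IsReduced ω) {i : B}
    (h : cs.length (cs.wordProd ω * cs.simple i) < cs.length (cs.wordProd ω)) :
    ∃ j < ω.length, cs.wordProd ω * cs.simple i = cs.wordProd (ω.eraseIdx j) := by
  have hmem : cs.simple i ∈ cs.rightInvSeq ω := by
    by_contra hn
    have h0 := par_zero cs hn
    have h1 := par_mul_simple cs (cs.wordProd ω) i
    obtain ⟨ω', hr, hw'⟩ := cs.exists_isReduced (cs.wordProd ω * cs.simple i)
    have hm : cs.simple i ∈ cs.rightInvSeq ω' := by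
      by_contra hn'
      have := par_zero cs hn'
      rw [← hw', h1, h0] at this
      simp at this
    have := (cs.isRightInversion_of_mem_rightInvSeq hr hm).2
    rw [← hw'] at this
    simp at this
    omega
  obtain ⟨j, hj, hje⟩ := List.getElem_of_mem hmem
  refine ⟨j, by simpa using hj, ?_⟩
  rw [← cs.wordProd_mul_getD_rightInvSeq, List.getD_eq_getElem _ _ hj, hje]

theorem exchange_append {c a : W} {i : B}
    (hca : cs.length (c * a) = cs.length c + cs.length a)
    (h : cs.length (c * a * cs.simple i) < cs.length (c * a)) :
    (∃ c', cs.length c' < cs.length c ∧ c * a * cs.simple i = c' * a) ∨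
    (∃ a', cs.length a' < cs.length a ∧ c * a * cs.simple i = c * a') := by
  obtain ⟨ω₁, h₁, rfl⟩ := cs.exists_isReduced c
  obtain ⟨ω₂, h₂, rfl⟩ := cs.exists_isReduced a
  have hr : cs.IsReduced (ω₁ ++ ω₂) := by
    rw [CoxeterSystem.IsReduced, wordProd_append, hca, h₁.eq, h₂.eq, length_append]
  rw [← wordProd_append] at h
  obtain ⟨j, hj, he⟩ := exchange cs hr h
  rw [wordProd_append] at he
  by_cases hlt : j < ω₁.length
  · left
    rw [eraseIdx_append_of_lt_length hlt, wordProd_append] at he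
    refine ⟨_, ?_, he⟩
    have := cs.length_wordProd_le (ω₁.eraseIdx j)
    rw [length_eraseIdx_of_lt hlt] at this
    rw [h₁.eq]; omega
  · right
    rw [eraseIdx_append_of_length_le (by omega), wordProd_append] at he
    refine ⟨_, ?_, he⟩
    have := cs.length_wordProd_le (ω₂.eraseIdx (j - ω₁.length))
    rw [length_append] at hj
    rw [length_eraseIdx_of_lt (by omega)] at this
    rw [h₂.eq]; omega

theorem conj_lemma {x : W} (hx : x * x = 1) {i : B}
    (h : cs.length (x * cs.simple i) < cs.length x) :
    x * cs.simple i = cs.simple i * x ∨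
      cs.length (cs.simple i * x * cs.simple i) + 2 ≤ cs.length x := by
  have hxi : x⁻¹ = x := inv_eq_of_mul_eq_one_left hx
  have hl : cs.length (cs.simple i * x) = cs.length (x * cs.simple i) := by
    rw [← cs.length_inv (x * cs.simple i), mul_inv_rev, hxi, inv_simple]
  have hd := cs.isRightDescent_iff.1 h
  have hxe : cs.simple i * (cs.simple i * x) = x := by simp
  have := exchange_append cs (c := cs.simple i) (a := cs.simple i * x) (i := i)
    (by rw [hxe, length_simple]; omega) (by rw [hxe]; exact h)
  rw [hxe] at this
  rcases this with ⟨c', hc, he⟩ | ⟨a', ha, he⟩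
  · left
    rw [length_simple] at hc
    have : c' = 1 := cs.length_eq_zero_iff.1 (by omega)
    rw [he, this, one_mul]
  · right
    rw [mul_assoc, he, simple_mul_simple_cancel_left]
    omega

/-- parabolic subgroup -/
def para (J : Set B) : Subgroup W := Subgroup.closure (cs.simple '' J)

theorem para_induction {J : Set B} {p : W → Prop} (h1 : p 1)
    (hs : ∀ a ∈ para cs J, ∀ i ∈ J, p a → p (a * cs.simple i)) : ∀ a ∈ para cs J, p a := by
  intro a ha
  induction ha using Subgroup.closure_induction_right with
  | one => exact h1
  | mul_right a ha y hy ih =>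
    obtain ⟨i, hi, rfl⟩ := hy
    exact hs a ha i hi ih
  | mul_inv_cancel a ha y hy ih =>
    obtain ⟨i, hi, rfl⟩ := hy
    rw [inv_simple]
    exact hs a ha i hi ih

theorem simple_mem_para {J : Set B} {i : B} (hi : i ∈ J) : cs.simple i ∈ para cs J :=
  Subgroup.subset_closure ⟨i, hi, rfl⟩

theorem length_min_mul {J : Set B} {c : W}
    (hc : ∀ a ∈ para cs J, cs.length c ≤ cs.length (c * a)) :
    ∀ a ∈ para cs J, cs.length (c * a) = cs.length c + cs.length a := by
  apply para_induction
  · simp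
  intro a ha i hi ih
  rw [← mul_assoc]
  rcases cs.length_mul_simple a i with h | h <;> rcases cs.length_mul_simple (c * a) i with h' | h'
  · omega
  · exfalso
    rcases exchange_append cs ih (i := i) (by omega) with ⟨c', hl, he⟩ | ⟨a', hl, he⟩
    · have : c' = c * (a * cs.simple i * a⁻¹) := by
        rw [← mul_assoc, ← mul_assoc, he]; simp
      have h2 := hc _ ((para cs J).mul_mem ((para cs J).mul_mem ha (simple_mem_para cs hi))
        ((para cs J).inv_mem ha))
      rw [← this] at h2
      omega
    · rw [mul_assoc, mul_right_inj] at he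
      rw [he] at h
      omega
  · have := cs.length_mul_le c (a * cs.simple i)
    rw [← mul_assoc] at this
    omega
  · omega

theorem exists_reduced_word {J : Set B} :
    ∀ a ∈ para cs J, ∃ ω : List B, cs.IsReduced ω ∧ (∀ i ∈ ω, i ∈ J) ∧ cs.wordProd ω = a := by
  apply para_induction
  · exact ⟨[], by simp [CoxeterSystem.IsReduced], by simp, by simp⟩
  rintro a - i hi ⟨ω, hr, hJ, rfl⟩
  rcases cs.length_mul_simple (cs.wordProd ω) i with h | h
  · refine ⟨ω ++ [i], ?_, ?_, ?_⟩
    · rw [CoxeterSystem.IsReduced, wordProd_append, wordProd_singleton, h, hr.eq]; simp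
    · intro k hk
      rcases mem_append.1 hk with hk | hk
      · exact hJ k hk
      · rw [mem_singleton.1 hk]; exact hi
    · rw [wordProd_append, wordProd_singleton]
  · obtain ⟨j, hj, he⟩ := exchange cs hr (i := i) (by omega)
    refine ⟨ω.eraseIdx j, ?_, fun k hk => hJ k (mem_of_mem_eraseIdx hk), he.symm⟩
    rw [CoxeterSystem.IsReduced, ← he, length_eraseIdx_of_lt hj]
    have := hr.eq
    omega

theorem exists_descent {J : Set B} {a : W} (ha : a ∈ para cs J) (h1 : a ≠ 1) :
    ∃ i ∈ J, cs.length (a * cs.simple i) < cs.length a := by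
  obtain ⟨ω, hr, hJ, rfl⟩ := exists_reduced_word cs a ha
  rcases List.eq_nil_or_concat ω with rfl | ⟨ω', i, rfl⟩
  · simp at h1
  refine ⟨i, hJ i (by simp), ?_⟩
  rw [hr.eq, wordProd_concat, simple_mul_simple_cancel_right]
  have := cs.length_wordProd_le ω'
  simp
  omega

theorem exists_min (J : Set B) (x : W) : ∃ c a : W, a ∈ para cs J ∧ x = c * a ∧
    ∀ a ∈ para cs J, cs.length c ≤ cs.length (c * a) := by
  obtain ⟨⟨a, ha⟩, -, hmin⟩ := WellFounded.has_min
    (InvImage.wf (fun a : para cs J => cs.length (x * a)) Nat.lt_wfRel.wf) Set.univ ⟨1, trivial⟩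
  refine ⟨x * a, a⁻¹, (para cs J).inv_mem ha, by simp, ?_⟩
  intro a' ha'
  have := hmin ⟨a * a', (para cs J).mul_mem ha ha'⟩ trivial
  simp only [InvImage, not_lt] at this
  rw [mul_assoc]
  exact not_lt.1 this

theorem min_of_no_descent {J : Set B} {x : W}
    (h : ∀ i ∈ J, ¬ cs.length (x * cs.simple i) < cs.length x) :
    ∀ a ∈ para cs J, cs.length (x * a) = cs.length x + cs.length a := by
  obtain ⟨c, a, ha, rfl, hc⟩ := exists_min cs J x
  by_cases h1 : a = 1
  · subst h1
    rw [mul_one]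
    exact length_min_mul cs hc
  · exfalso
    obtain ⟨i, hi, hd⟩ := exists_descent cs ha h1
    apply h i hi
    rw [mul_assoc, length_min_mul cs hc a ha,
      length_min_mul cs hc _ ((para cs J).mul_mem ha (simple_mem_para cs hi))]
    omega

theorem mem_para {y : W} (hy : y * y = 1)
    (h : ∀ i, cs.length (y * cs.simple i) < cs.length y → y * cs.simple i = cs.simple i * y) :
    y ∈ para cs {i | cs.length (y * cs.simple i) < cs.length y} := by
  set J : Set B := {i | cs.length (y * cs.simple i) < cs.length y} with hJ
  have hyi : y⁻¹ = y := inv_eq_of_mul_eq_one_left hy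
  obtain ⟨c, a, ha, hca, hc⟩ := exists_min cs J y
  by_cases h1 : c = 1
  · rw [hca, h1, one_mul]; exact ha
  exfalso
  obtain ⟨i, hi⟩ := cs.exists_leftDescent_of_ne_one h1
  rw [IsLeftDescent] at hi
  have hl : cs.length (cs.simple i * y) = cs.length (y * cs.simple i) := by
    rw [← cs.length_inv (y * cs.simple i), mul_inv_rev, hyi, inv_simple]
  have h2 := length_min_mul cs hc a ha
  rw [← hca] at h2
  have h3 := cs.length_mul_le (cs.simple i * c) a
  rw [mul_assoc, ← hca] at h3
  have hiJ : cs.length (y * cs.simple i) < cs.length y := by omega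
  have hcomm := h i hiJ
  have h4 := hc (a * cs.simple i * a⁻¹) ((para cs J).mul_mem
    ((para cs J).mul_mem ha (simple_mem_para cs hiJ)) ((para cs J).inv_mem ha))
  rw [← mul_assoc, ← mul_assoc, ← hca, hcomm, hca] at h4
  rw [← mul_assoc, mul_inv_cancel_right] at h4
  omega

theorem main (n : ℕ) : ∀ x y : W, x * x = 1 → y * y = 1 →
    cs.length x + 2 * cs.length y = n →
    ∃ σ τ : W, IsConj (x * y) (σ * τ) ∧ σ * σ = 1 ∧ τ * τ = 1 ∧
      cs.length (σ * τ) = cs.length σ + cs.length τ := by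
  induction n using Nat.strong_induction_on with
  | _ n ih =>
  intro x y hx hy hn
  -- conjugation step
  have conjstep : ∀ i, cs.length (cs.simple i * x * cs.simple i) +
      2 * cs.length (cs.simple i * y * cs.simple i) < n →
      ∃ σ τ : W, IsConj (x * y) (σ * τ) ∧ σ * σ = 1 ∧ τ * τ = 1 ∧
      cs.length (σ * τ) = cs.length σ + cs.length τ := by
    intro i hlt
    have hinv : ∀ z : W, z * z = 1 →
        (cs.simple i * z * cs.simple i) * (cs.simple i * z * cs.simple i) = 1 := by
      intro z hz
      calc _ = cs.simple i * (z * (cs.simple i * cs.simple i) * z) * cs.simple i := by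
            simp only [mul_assoc]
        _ = 1 := by rw [simple_mul_simple_self, mul_one, hz, mul_one, simple_mul_simple_self]
    obtain ⟨σ, τ, hc, h⟩ := ih _ hlt _ _ (hinv x hx) (hinv y hy) rfl
    refine ⟨σ, τ, IsConj.trans (isConj_iff.2 ⟨cs.simple i, ?_⟩) hc, h⟩
    simp [mul_assoc]
  have hxl := fun i => cs.length_mul_simple x i
  by_cases hA : ∃ i, cs.length (y * cs.simple i) < cs.length y ∧
      y * cs.simple i ≠ cs.simple i * y
  · obtain ⟨i, hd, hne⟩ := hA
    apply conjstep i
    have h1 := (conj_lemma cs hy hd).resolve_left hne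
    have h2 := cs.length_simple_mul (x * cs.simple i) i
    have h3 := hxl i
    rw [← mul_assoc] at h2
    omega
  push Not at hA
  by_cases hB : ∃ i, cs.length (y * cs.simple i) < cs.length y ∧
      cs.length (x * cs.simple i) < cs.length x
  · obtain ⟨i, hdy, hdx⟩ := hB
    have hcy := hA i hdy
    rcases conj_lemma cs hx hdx with hcx | hcx
    · have h1 : (x * cs.simple i) * (x * cs.simple i) = 1 := by
        nth_rewrite 2 [hcx]
        rw [mul_assoc, simple_mul_simple_cancel_left, hx]
      have h2 : (cs.simple i * y) * (cs.simple i * y) = 1 := by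
        nth_rewrite 1 [← hcy]
        rw [mul_assoc, simple_mul_simple_cancel_left, hy]
      obtain ⟨σ, τ, hc, h⟩ := ih _ (by rw [← hcy]; omega) _ _ h1 h2 rfl
      refine ⟨σ, τ, ?_, h⟩
      rwa [mul_assoc, simple_mul_simple_cancel_left] at hc
    · apply conjstep i
      rw [← hcy, simple_mul_simple_cancel_right]
      omega
  push Not at hB
  refine ⟨x, y, IsConj.refl _, hx, hy, ?_⟩
  exact min_of_no_descent cs (fun i hi => not_lt.2 (hB i hi)) y (mem_para cs hy hA)

end ExcessZero

/-- **Hart–Rowley, Theorem 1.1.** Every strongly real element of a Coxeter group is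
conjugate to an element of excess zero: if `w = x * y` with `x² = 1 = y²`, then there is a
conjugate `w*` of `w` and involutions `σ`, `τ` with `w* = σ * τ` and
`ℓ(w*) = ℓ(σ) + ℓ(τ)`. -/
theorem excess_zero_in_conjugacy_class {B W : Type*} [Group W] {M : CoxeterMatrix B}
    (cs : CoxeterSystem M W) (w : W)
    (hw : ∃ x y : W, x ^ 2 = 1 ∧ y ^ 2 = 1 ∧ w = x * y) :
    ∃ wStar σ τ : W, IsConj w wStar ∧ σ ^ 2 = 1 ∧ τ ^ 2 = 1 ∧ wStar = σ * τ ∧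
      cs.length wStar = cs.length σ + cs.length τ := by
  obtain ⟨x, y, hx, hy, rfl⟩ := hw
  obtain ⟨σ, τ, hc, hs, ht, hl⟩ := ExcessZero.main cs _ x y (by rw [← pow_two, hx])
    (by rw [← pow_two, hy]) rfl
  exact ⟨σ * τ, σ, τ, hc, by rw [pow_two, hs], by rw [pow_two, ht], rfl, hl⟩
end

section
/- Let n ≥ 3 be odd and let w = (1 2 ⋯ n) ∈ Sym(n). Put k = (n−1)/2 and let y_k be as below. Then y_k² = 1, (w y_k)² = 1, w = (w y_k)·y_k, and ℓ(w y_k) + ℓ(y_k) − ℓ(w) = e(w); that is, (w y_k, y_k) is a spartan pair for w. -/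
/-- The inversion number of a permutation of `{0, …, n−1}`, which equals the Coxeter
length of the permutation in `W(A_{n−1}) ≅ Sym(n)`. -/
def invNum {n : ℕ} (σ : Equiv.Perm (Fin n)) : ℕ :=
  (Finset.univ.filter fun p : Fin n × Fin n => p.1 < p.2 ∧ σ p.2 < σ p.1).card

/-- The underlying function of `y_k`: `j ↦ k - 1 - j` for `j < k` and
`j ↦ n + k - 1 - j` for `k ≤ j < n` (the zero-indexed form of the permutation of
`{1, …, n}` sending `i ↦ k + 1 - i` for `1 ≤ i ≤ k` and `i ↦ n + k + 1 - i` for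
`k + 1 ≤ i ≤ n`). -/
def ykFun (n k : ℕ) (hk : k ≤ n) (j : Fin n) : Fin n :=
  if _h : (j : ℕ) < k then ⟨k - 1 - j, by omega⟩ else ⟨n + k - 1 - j, by omega⟩

lemma ykFun_involutive (n k : ℕ) (hk : k ≤ n) : Function.Involutive (ykFun n k hk) := by
  intro j
  unfold ykFun
  by_cases h1 : (j : ℕ) < k
  · rw [dif_pos h1, dif_pos (by simp; omega)]
    apply Fin.ext; simp; omega
  · rw [dif_neg h1, dif_neg (by simp; omega)]
    apply Fin.ext; simp; omega

/-- The involution `y_k` of Hart–Rowley, Proposition 2.8. -/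
def yk (n k : ℕ) (hk : k ≤ n) : Equiv.Perm (Fin n) := (ykFun_involutive n k hk).toPerm


/-- The excess of a permutation `w`:
`e(w) = min{ℓ(x) + ℓ(y) − ℓ(w) : w = xy, x² = 1 = y²}`. -/
noncomputable def excess {n : ℕ} (w : Equiv.Perm (Fin n)) : ℕ :=
  sInf {m : ℕ | ∃ x y : Equiv.Perm (Fin n), x ^ 2 = 1 ∧ y ^ 2 = 1 ∧ w = x * y ∧
    m = invNum x + invNum y - invNum w}

lemma rot_val (n : ℕ) (i : Fin n) :
    ((finRotate n i : Fin n) : ℕ) = if (i : ℕ) + 1 = n then 0 else (i : ℕ) + 1 := by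
  cases n with
  | zero => exact i.elim0
  | succ m =>
    rw [coe_finRotate]
    simp [Fin.ext_iff]

lemma yk_val (n k : ℕ) (hk : k ≤ n) (j : Fin n) :
    ((yk n k hk j : Fin n) : ℕ) = if (j : ℕ) < k then k - 1 - j else n + k - 1 - j := by
  change ((ykFun n k hk j : Fin n) : ℕ) = _
  unfold ykFun
  split_ifs <;> rfl

lemma yk_sq (n k : ℕ) (hk : k ≤ n) : (yk n k hk) ^ 2 = 1 := by
  ext j
  rw [pow_two, Equiv.Perm.mul_apply]
  change ((ykFun n k hk (ykFun n k hk j) : Fin n) : ℕ) = _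
  rw [ykFun_involutive]; rfl

lemma rot_yk (n k : ℕ) (hk : k < n) :
    finRotate n * yk n k hk.le = yk n (k + 1) hk := by
  ext j
  have := j.2
  rw [Equiv.Perm.mul_apply, rot_val, yk_val, yk_val]
  split_ifs <;> omega

lemma card_lt_ge (n a b : ℕ) (hb : b ≤ n) :
    (Finset.univ.filter fun i : Fin n => a ≤ (i : ℕ) ∧ (i : ℕ) < b).card = b - a := by
  rw [← Nat.card_Ico, ← Finset.card_map Fin.valEmbedding]
  congr 1
  ext x
  simp only [Finset.mem_map, Finset.mem_filter, Finset.mem_univ, true_and, Finset.mem_Ico,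
    Fin.valEmbedding_apply]
  constructor
  · rintro ⟨i, h, rfl⟩; exact h
  · intro h; exact ⟨⟨x, by omega⟩, h, rfl⟩

lemma inv_yk (k m : ℕ) (hk : k ≤ k + m) :
    invNum (yk (k + m) k hk) * 2 = k * (k - 1) + m * (m - 1) := by
  have h : invNum (yk (k + m) k hk) =
      ∑ j : Fin (k + m), (if (j : ℕ) < k then (j : ℕ) else (j : ℕ) - k) := by
    unfold invNum
    rw [Finset.card_filter, Fintype.sum_prod_type_right]
    refine Finset.sum_congr rfl fun j _ => ?_
    rw [← Finset.card_filter]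
    have hj := j.2
    have e : (if (j : ℕ) < k then (j : ℕ) else (j : ℕ) - k)
        = (j : ℕ) - (if (j : ℕ) < k then 0 else k) := by split_ifs <;> omega
    rw [e, ← card_lt_ge (k + m) _ j hj.le]
    congr 1
    ext i
    have hi := i.2
    simp only [Finset.mem_filter, Finset.mem_univ, true_and, Fin.lt_def, yk_val]
    split_ifs <;> omega
  rw [h, Fin.sum_univ_eq_sum_range (fun j => if j < k then j else j - k), Finset.sum_range_add,
    add_mul]
  congr 1
  · rw [← Finset.sum_range_id_mul_two]
    congr 1
    refine Finset.sum_congr rfl fun j hj => ?_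
    rw [if_pos (Finset.mem_range.1 hj)]
  · rw [← Finset.sum_range_id_mul_two]
    congr 1
    refine Finset.sum_congr rfl fun j hj => ?_
    rw [if_neg (by omega)]; omega

lemma inv_sum (n k : ℕ) (hk : k < n) :
    invNum (finRotate n * yk n k hk.le) + invNum (yk n k hk.le) = k ^ 2 + (n - 1 - k) ^ 2 := by
  rw [rot_yk n k hk]
  obtain ⟨m, rfl⟩ : ∃ m, n = k + 1 + m := ⟨n - (k + 1), by omega⟩
  have h1 := inv_yk (k + 1) m (by omega)
  have h2 : invNum (yk (k + 1 + m) k hk.le) * 2 = k * (k - 1) + (m + 1) * m := by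
    have h3 := inv_yk k (m + 1) (by omega)
    have h4 : ∀ N (_ : N = k + (m + 1)) (h : k ≤ N),
        invNum (yk N k h) = invNum (yk (k + (m + 1)) k (by omega)) := by
      rintro N rfl h; rfl
    rw [h4 _ (by omega), h3]; simp
  have e : k + 1 + m - 1 - k = m := by omega
  rw [e]
  have a : ∀ t : ℕ, t * (t - 1) + t = t * t := by
    intro t; cases t <;> simp; ring
  have := a k
  have := a m
  simp only [Nat.add_sub_cancel] at h1
  generalize invNum (yk (k + 1 + m) (k + 1) _) = A at h1 ⊢
  generalize invNum (yk (k + 1 + m) k _) = B at h2 ⊢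
  nlinarith

lemma y_eq (n : ℕ) (hn : 3 ≤ n) (x y : Equiv.Perm (Fin n)) (hx : x ^ 2 = 1) (hy : y ^ 2 = 1)
    (h : finRotate n = x * y) : ∃ k, ∃ hk : k < n, y = yk n k hk.le ∧ x = finRotate n * y := by
  have hxw : x = finRotate n * y := by
    rw [h, mul_assoc, ← pow_two, hy, mul_one]
  have key : ∀ i, finRotate n (y (finRotate n i)) = y i := by
    intro i
    have h1 : finRotate n * y * (finRotate n * y) = 1 := by rw [← hxw, ← pow_two, hx]
    have h2 : finRotate n * y * finRotate n = y := by
      have : finRotate n * y * finRotate n * (y * y) = y := by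
        calc finRotate n * y * finRotate n * (y * y)
            = finRotate n * y * (finRotate n * y) * y := by simp only [mul_assoc]
          _ = y := by rw [h1, one_mul]
      rwa [← pow_two, hy, mul_one] at this
    exact congrArg (fun σ : Equiv.Perm (Fin n) => σ i) h2
  let z : Fin n := ⟨0, by omega⟩
  have hc := (y z).2
  refine ⟨if (y z : ℕ) + 1 = n then 0 else (y z : ℕ) + 1, by split_ifs <;> omega, ?_, hxw⟩
  have main : ∀ i (hi : i < n), (y ⟨i, hi⟩ : ℕ) =
      if (y z : ℕ) + 1 = n then n - 1 - i else
        if i < (y z : ℕ) + 1 then (y z : ℕ) - i else n + (y z : ℕ) - i := by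
    intro i
    induction i with
    | zero =>
      intro hi
      change (y z : ℕ) = _
      split_ifs <;> omega
    | succ i ih =>
      intro hi
      have h1 := ih (by omega)
      have h2 := key ⟨i, by omega⟩
      have h3 : finRotate n ⟨i, by omega⟩ = ⟨i + 1, hi⟩ := by
        apply Fin.ext
        rw [rot_val, if_neg (by simp; omega)]
      rw [h3] at h2
      have h4 := congrArg Fin.val h2
      rw [rot_val, h1] at h4
      have h5 := (y ⟨i + 1, hi⟩).2
      split_ifs at h4 ⊢ <;> omega
  ext j
  have h1 := main j j.2
  have := j.2
  rw [yk_val]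
  change (y j : ℕ) = _ at h1
  rw [h1]
  split_ifs <;> omega

/-- **Hart–Rowley, Proposition 2.8(ii).** For odd `n ≥ 3`, the pair
`(w y_k, y_k)` with `k = (n−1)/2` is a spartan pair for the `n`-cycle
`w = (1 2 ⋯ n)` (zero-indexed: `finRotate n`): both components are involutions whose
product is `w`, and `ℓ(w y_k) + ℓ(y_k) − ℓ(w)` attains the excess `e(w)`. -/
theorem spartan_pair_of_cycle_odd (n : ℕ) (hn : 3 ≤ n) (hodd : Odd n) :
    (yk n ((n - 1) / 2) (by omega)) ^ 2 = 1 ∧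
      (finRotate n * yk n ((n - 1) / 2) (by omega)) ^ 2 = 1 ∧
      finRotate n = (finRotate n * yk n ((n - 1) / 2) (by omega)) * yk n ((n - 1) / 2) (by omega) ∧
      invNum (finRotate n * yk n ((n - 1) / 2) (by omega)) + invNum (yk n ((n - 1) / 2) (by omega))
        - invNum (finRotate n) = excess (finRotate n) := by
  have hk : (n - 1) / 2 < n := by omega
  refine ⟨yk_sq _ _ _, ?_, ?_, ?_⟩
  · rw [rot_yk n _ hk]; exact yk_sq _ _ _
  · rw [mul_assoc, ← pow_two, yk_sq, mul_one]
  · apply le_antisymm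
    · unfold excess
      apply le_csInf
      · exact ⟨_, finRotate n * yk n ((n - 1) / 2) hk.le, yk n ((n - 1) / 2) hk.le, by rw [rot_yk n _ hk]; exact yk_sq _ _ _, yk_sq n _ hk.le,
          by rw [mul_assoc, ← pow_two, yk_sq, mul_one], rfl⟩
      · rintro m ⟨x, y, hx, hy, hw, rfl⟩
        obtain ⟨k, hkn, rfl, rfl⟩ := y_eq n hn x y hx hy hw
        apply Nat.sub_le_sub_right
        rw [inv_sum n _ hk, inv_sum n k hkn]
        obtain ⟨t, rfl⟩ := hodd
        have e1 : (2 * t + 1 - 1) / 2 = t := by omega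
        have e2 : 2 * t + 1 - 1 - t = t := by omega
        rw [e1, e2]
        obtain ⟨r, hr⟩ : ∃ r, r = 2 * t + 1 - 1 - k := ⟨_, rfl⟩
        rw [← hr]
        have e3 : k + r = 2 * t := by omega
        zify at e3 ⊢
        nlinarith [sq_nonneg ((k : ℤ) - r)]
    · unfold excess
      apply Nat.sInf_le
      exact ⟨_, _, by rw [rot_yk n _ hk]; exact yk_sq _ _ _, yk_sq n _ hk.le,
          by rw [mul_assoc, ← pow_two, yk_sq, mul_one], rfl⟩
end
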